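/- Let K¹,K² be continuous symmetric positive definite kernels on T with ∫_T K^i(x,x) dν(x) ≤ κ_i². Let C_{K^i}: L²(T,ν) → L²(T,ν) be the integral operator (C_{K^i}f)(x) = ∫_T K^i(x,t) f(t) dν(t), and R_{12} = ∫_T K¹_t ⊗ K²_t dν(t): H_{K²} → H_{K¹}. Then the positive self-adjoint compact operators C_{K¹}^{1/2} C_{K²} C_{K¹}^{1/2} on L²(T,ν) and R_{12}* R_{12} on H_{K²} have the same nonzero eigenvalues (with multiplicities); consequently tr[(C_{K¹}^{1/2} C_{K²} C_{K¹}^{1/2})^{1/2}] = tr[(R_{12}* R_{12})^{1/2}], and tr(C_{K^i}) = tr(L_{K^i}) where L_{K^i} = R_{K^i} R_{K^i}*. -/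

import Mathlib

/- STATEMENT 5: `K¹,K²` continuous symmetric positive definite kernels with
`∫ K^i(x,x) dν ≤ κ_i²`.  `C_{K^i}` is the integral operator on `L²(T,ν)`;
`R_{12} = ∫ K¹_t ⊗ K²_t dν : H_{K²} → H_{K¹}` (feature-map encoding of the RKHSs);
`L_{K^i} = ∫ K^i_t ⊗ K^i_t dν` on `H_{K^i}`.  With `sqC1` the positive square root of
`C_{K¹}`, the operators `M = C_{K¹}^{1/2} C_{K²} C_{K¹}^{1/2} = sqC1 ∘ C2 ∘ sqC1` on
`L²(T,ν)` and `R_{12}* R_{12}` on `H_{K²}` have the same nonzero eigenvalues with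
multiplicities (equal dimensions of eigenspaces for each `μ ≠ 0`); consequently
`tr(M^{1/2}) = tr((R_{12}* R_{12})^{1/2})` (square roots encoded as the unique positive
operators squaring to them, traces along Hilbert bases `eL`, `e2`); and
`tr(C_{K^i}) = tr(L_{K^i})`. -/

open MeasureTheory
open scoped RealInnerProductSpace

noncomputable section

universe uT uH1 uH2

universe u v

namespace ContinuousLinearMap

variable {E : Type u} {F : Type v} [NormedAddCommGroup E] [InnerProductSpace ℝ E]
  [NormedAddCommGroup F] [InnerProductSpace ℝ F]

theorem _root_.HilbertBasis.tsum_ofReal_inner_sq {ι : Type*} (b : HilbertBasis ι ℝ E) (x : E) :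
    ∑' i, ENNReal.ofReal (⟪b i, x⟫ ^ 2) = ENNReal.ofReal (‖x‖ ^ 2) := by
  have h : HasSum (fun i => ⟪b i, x⟫ ^ 2) (‖x‖ ^ 2) := by
    rw [← real_inner_self_eq_norm_sq]
    refine (b.hasSum_inner_mul_inner x x).congr_fun fun i => ?_
    rw [real_inner_comm (b i) x, sq]
  rw [← h.tsum_eq, ENNReal.ofReal_tsum_of_nonneg (fun _ => sq_nonneg _) h.summable]

theorem tsum_eq_of_tsum_ofReal_eq {ι κ : Type*} {f : ι → ℝ} {g : κ → ℝ}
    (hf : ∀ i, 0 ≤ f i) (hg : ∀ i, 0 ≤ g i)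
    (h : ∑' i, ENNReal.ofReal (f i) = ∑' i, ENNReal.ofReal (g i)) :
    ∑' i, f i = ∑' i, g i := by
  have := congrArg ENNReal.toReal h
  rw [ENNReal.tsum_toReal_eq fun _ => ENNReal.ofReal_ne_top,
    ENNReal.tsum_toReal_eq fun _ => ENNReal.ofReal_ne_top] at this
  simpa only [ENNReal.toReal_ofReal (hf _), ENNReal.toReal_ofReal (hg _)] using this

/-- The trace of a positive operator with an orthonormal eigenbasis, computed along any Hilbert
basis, is the sum of its eigenvalues. -/
theorem tsum_ofReal_inner_apply_eq_tsum_eigenvalues {ι κ : Type*} {S : E →L[ℝ] E}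
    (hS : (S : E →ₗ[ℝ] E).IsSymmetric) (e : HilbertBasis κ ℝ E) (b : HilbertBasis ι ℝ E)
    {σ : ι → ℝ} (hσ : ∀ j, 0 ≤ σ j) (hb : ∀ j, S (b j) = σ j • b j) :
    ∑' k, ENNReal.ofReal ⟪e k, S (e k)⟫ = ∑' j, ENNReal.ofReal (σ j) := by
  have key : ∀ x : E, ENNReal.ofReal ⟪x, S x⟫ =
      ∑' j, ENNReal.ofReal (σ j) * ENNReal.ofReal (⟪x, b j⟫ ^ 2) := by
    intro x
    have h : HasSum (fun j => σ j * ⟪x, b j⟫ ^ 2) ⟪x, S x⟫ := by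
      refine (b.hasSum_inner_mul_inner x (S x)).congr_fun fun j => ?_
      have : ⟪b j, S x⟫ = ⟪S (b j), x⟫ := (hS (b j) x).symm
      rw [this, hb, real_inner_smul_left, real_inner_comm x (b j)]
      ring
    rw [← h.tsum_eq, ENNReal.ofReal_tsum_of_nonneg
      (fun j => mul_nonneg (hσ j) (sq_nonneg _)) h.summable]
    exact tsum_congr fun j => ENNReal.ofReal_mul (hσ j)
  simp_rw [key]
  rw [ENNReal.tsum_comm]
  refine tsum_congr fun j => ?_
  rw [ENNReal.tsum_mul_left, e.tsum_ofReal_inner_sq, b.orthonormal.norm_eq_one]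
  simp

theorem exists_hilbertBasis_eigenvectors [CompleteSpace E] {A : E →L[ℝ] E}
    (hA : (A : E →ₗ[ℝ] E).IsSymmetric)
    (hspan : (⨆ μ, Module.End.eigenspace (A : E →ₗ[ℝ] E) μ)ᗮ = ⊥) :
    ∃ (ι : Type u) (b : HilbertBasis ι ℝ E) (l : ι → ℝ), ∀ j, A (b j) = l j • b j := by
  have hclosed : ∀ μ, IsClosed (Module.End.eigenspace (A : E →ₗ[ℝ] E) μ : Set E) := fun μ => by
    have : (Module.End.eigenspace (A : E →ₗ[ℝ] E) μ : Set E) = {x | A x = μ • x} := by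
      ext x
      simp
    rw [this]
    exact isClosed_eq A.continuous (continuous_const_smul μ)
  have hcomplete : ∀ μ, CompleteSpace (Module.End.eigenspace (A : E →ₗ[ℝ] E) μ) :=
    fun μ => (hclosed μ).completeSpace_coe
  choose w v _ using fun μ => exists_hilbertBasis ℝ (Module.End.eigenspace (A : E →ₗ[ℝ] E) μ)
  have hon := hA.orthogonalFamily_eigenspaces.orthonormal_sigma_orthonormal
    fun μ => (v μ).orthonormal
  refine ⟨Σ μ, w μ, HilbertBasis.mkOfOrthogonalEqBot hon ?_, fun j => j.1, fun j => ?_⟩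
  · rw [eq_bot_iff, ← hspan]
    intro x hx
    rw [← Submodule.iInf_orthogonal, Submodule.mem_iInf]
    intro μ y hy
    have h : HasSum (fun i => (v μ).repr ⟨y, hy⟩ i * ⟪(v μ i : E), x⟫) ⟪y, x⟫ := by
      have := (((v μ).hasSum_repr ⟨y, hy⟩).mapL (Submodule.subtypeL _)).mapL
        (innerSL ℝ x)
      simpa [real_inner_smul_right, real_inner_comm x] using! this
    refine h.unique ?_
    convert hasSum_zero with i
    have h0 : ⟪(v μ i : E), x⟫ = 0 := hx _ (Submodule.subset_span ⟨⟨μ, i⟩, rfl⟩)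
    exact mul_eq_zero_of_right _ h0
  · rw [HilbertBasis.coe_mkOfOrthogonalEqBot]
    exact Module.End.mem_eigenspace_iff.mp (v j.1 j.2).2

theorem IsPositive.apply_eq_sqrt_smul {S : E →L[ℝ] E} (hS : S.IsPositive) {x : E} {μ : ℝ}
    (hx : x ≠ 0) (h : S (S x) = μ • x) : S x = √μ • x := by
  have hsymm : ∀ x y, ⟪S x, y⟫ = ⟪x, S y⟫ := fun x y => hS.isSymmetric x y
  have hnorm : ‖S x‖ ^ 2 = μ * ‖x‖ ^ 2 := by
    rw [← real_inner_self_eq_norm_sq, hsymm, h, real_inner_smul_right, real_inner_self_eq_norm_sq]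
  have hxpos : 0 < ‖x‖ ^ 2 := by positivity
  have hμ : 0 ≤ μ := by
    by_contra! hlt
    nlinarith [sq_nonneg ‖S x‖]
  rcases hμ.eq_or_lt with rfl | hpos
  · rw [zero_mul, sq_eq_zero_iff, norm_eq_zero] at hnorm
    simp [hnorm]
  · set y := S x - √μ • x with hy
    have hSy : S y = -(√μ • y) := by
      rw [hy, map_sub, map_smul, h, smul_sub, smul_smul, Real.mul_self_sqrt hμ]
      abel
    have hnn : 0 ≤ ⟪y, S y⟫ := hS.inner_nonneg_right y
    rw [hSy, inner_neg_right, real_inner_smul_right, real_inner_self_eq_norm_sq] at hnn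
    have h0 : ‖y‖ ^ 2 ≤ 0 := by
      have := Real.sqrt_pos.mpr hpos
      by_contra! hlt
      nlinarith [mul_pos this hlt]
    rw [← sub_eq_zero, ← hy, ← norm_eq_zero]
    exact sq_eq_zero_iff.mp (le_antisymm h0 (sq_nonneg _))

theorem exists_hilbertBasis_eigenvectors_of_comp_self_eq [CompleteSpace E] {S A : E →L[ℝ] E}
    (hS : S.IsPositive) (hSA : S ∘L S = A)
    (hspan : (⨆ μ, Module.End.eigenspace (A : E →ₗ[ℝ] E) μ)ᗮ = ⊥) :
    ∃ (ι : Type u) (b : HilbertBasis ι ℝ E) (σ : ι → ℝ),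
      (∀ j, 0 ≤ σ j) ∧ ∀ j, S (b j) = σ j • b j := by
  have hA : (A : E →ₗ[ℝ] E).IsSymmetric := fun x y => by
    subst hSA
    exact (hS.isSymmetric (S x) y).trans (hS.isSymmetric x (S y))
  obtain ⟨ι, b, l, hb⟩ := exists_hilbertBasis_eigenvectors hA hspan
  refine ⟨ι, b, fun j => √(l j), fun j => Real.sqrt_nonneg _, fun j => ?_⟩
  refine hS.apply_eq_sqrt_smul (b.orthonormal.ne_zero j) ?_
  rw [← hb, ← hSA, comp_apply]

variable [CompleteSpace E] [CompleteSpace F] (B : E →L[ℝ] F)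

/-- For `μ ≠ 0`, `B` maps the `μ`-eigenspace of `B† B` isomorphically onto that of `B B†`. -/
def eigenspaceAdjointCompEquiv {μ : ℝ} (hμ : μ ≠ 0) :
    Module.End.eigenspace ((B.adjoint ∘L B : E →L[ℝ] E) : E →ₗ[ℝ] E) μ ≃ₗ[ℝ]
      Module.End.eigenspace ((B ∘L B.adjoint : F →L[ℝ] F) : F →ₗ[ℝ] F) μ :=
  LinearEquiv.ofLinearMap
    (LinearMap.restrict (B : E →ₗ[ℝ] F) fun x hx => by
      rw [Module.End.mem_eigenspace_iff] at hx ⊢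
      exact (congrArg B hx).trans (map_smul B μ x))
    (μ⁻¹ • LinearMap.restrict (B.adjoint : F →ₗ[ℝ] E) fun x hx => by
      rw [Module.End.mem_eigenspace_iff] at hx ⊢
      exact (congrArg B.adjoint hx).trans (map_smul B.adjoint μ x))
    (by
      ext ⟨x, hx⟩
      have h : B (B.adjoint x) = μ • x := Module.End.mem_eigenspace_iff.mp hx
      change B (μ⁻¹ • B.adjoint x) = x
      rw [map_smul, h, inv_smul_smul₀ hμ])
    (by
      ext ⟨x, hx⟩
      have h : B.adjoint (B x) = μ • x := Module.End.mem_eigenspace_iff.mp hx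
      change μ⁻¹ • B.adjoint (B x) = x
      rw [h, inv_smul_smul₀ hμ])

theorem iSup_eigenspace_comp_adjoint_orthogonal_eq_bot
    (hspan : (⨆ μ, Module.End.eigenspace ((B.adjoint ∘L B : E →L[ℝ] E) : E →ₗ[ℝ] E) μ)ᗮ = ⊥) :
    (⨆ μ, Module.End.eigenspace ((B ∘L B.adjoint : F →L[ℝ] F) : F →ₗ[ℝ] F) μ)ᗮ = ⊥ := by
  rw [eq_bot_iff]
  intro x hx
  rw [← Submodule.iInf_orthogonal, Submodule.mem_iInf] at hx
  have hBx : B.adjoint x ∈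
      (⨆ μ, Module.End.eigenspace ((B.adjoint ∘L B : E →L[ℝ] E) : E →ₗ[ℝ] E) μ)ᗮ := by
    rw [← Submodule.iInf_orthogonal, Submodule.mem_iInf]
    intro μ y hy
    rw [adjoint_inner_right]
    refine hx μ _ ?_
    rw [Module.End.mem_eigenspace_iff] at hy ⊢
    exact (congrArg B hy).trans (map_smul B μ y)
  rw [hspan, Submodule.mem_bot] at hBx
  have h0 : ⟪x, x⟫ = 0 := hx 0 x <| by
    rw [Module.End.mem_eigenspace_iff]
    simp [hBx]
  exact inner_self_eq_zero.mp h0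

theorem tsum_ofReal_inner_comp_adjoint {ι κ : Type*} (e : HilbertBasis ι ℝ E)
    (f : HilbertBasis κ ℝ F) :
    ∑' k, ENNReal.ofReal ⟪f k, (B ∘L B.adjoint) (f k)⟫ =
      ∑' k, ENNReal.ofReal ⟪e k, (B.adjoint ∘L B) (e k)⟫ := by
  have h1 : ∀ x, ⟪x, (B ∘L B.adjoint) x⟫ = ‖B.adjoint x‖ ^ 2 := fun x => by
    rw [comp_apply, ← adjoint_inner_left, real_inner_self_eq_norm_sq]
  have h2 : ∀ x, ⟪x, (B.adjoint ∘L B) x⟫ = ‖B x‖ ^ 2 := fun x => by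
    rw [comp_apply, adjoint_inner_right, real_inner_self_eq_norm_sq]
  simp_rw [h1, h2, ← e.tsum_ofReal_inner_sq, ← f.tsum_ofReal_inner_sq, adjoint_inner_right]
  rw [ENNReal.tsum_comm]
  simp_rw [real_inner_comm]

theorem tsum_inner_comp_adjoint {ι κ : Type*} (e : HilbertBasis ι ℝ E) (f : HilbertBasis κ ℝ F) :
    ∑' k, ⟪f k, (B ∘L B.adjoint) (f k)⟫ = ∑' k, ⟪e k, (B.adjoint ∘L B) (e k)⟫ := by
  refine tsum_eq_of_tsum_ofReal_eq (fun k => ?_) (fun k => ?_)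
    (B.tsum_ofReal_inner_comp_adjoint e f)
  · rw [comp_apply, ← adjoint_inner_left]
    exact real_inner_self_nonneg
  · rw [comp_apply, adjoint_inner_right]
    exact real_inner_self_nonneg

/-- The positive square roots of `B B†` and `B† B` have the same trace, provided that the
eigenspaces of `B† B` span a dense subspace. -/
theorem tsum_inner_sqrt_comp_adjoint {ι κ : Type*} (e : HilbertBasis ι ℝ E)
    (f : HilbertBasis κ ℝ F)
    (hspan : (⨆ μ, Module.End.eigenspace ((B.adjoint ∘L B : E →L[ℝ] E) : E →ₗ[ℝ] E) μ)ᗮ = ⊥)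
    {P : F →L[ℝ] F} (hP : P.IsPositive) (hPB : P ∘L P = B ∘L B.adjoint)
    {Q : E →L[ℝ] E} (hQ : Q.IsPositive) (hQB : Q ∘L Q = B.adjoint ∘L B) :
    ∑' k, ⟪f k, P (f k)⟫ = ∑' k, ⟪e k, Q (e k)⟫ := by
  obtain ⟨ι', b, σ, hσ, hb⟩ := exists_hilbertBasis_eigenvectors_of_comp_self_eq hQ hQB hspan
  obtain ⟨κ', c, τ, hτ, hc⟩ := exists_hilbertBasis_eigenvectors_of_comp_self_eq hP hPB
    (B.iSup_eigenspace_comp_adjoint_orthogonal_eq_bot hspan)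
  refine tsum_eq_of_tsum_ofReal_eq (fun k => hP.inner_nonneg_right _)
    (fun k => hQ.inner_nonneg_right _) ?_
  rw [tsum_ofReal_inner_apply_eq_tsum_eigenvalues hP.isSymmetric f c hτ hc,
    tsum_ofReal_inner_apply_eq_tsum_eigenvalues hQ.isSymmetric e b hσ hb]
  have hBb : ∀ j, B.adjoint (B (b j)) = σ j ^ 2 • b j := fun j => by
    rw [← comp_apply, ← hQB, comp_apply, hb, map_smul, hb, smul_smul, sq]
  have hBc : ∀ i, B (B.adjoint (c i)) = τ i ^ 2 • c i := fun i => by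
    rw [← comp_apply, ← hPB, comp_apply, hc, map_smul, hc, smul_smul, sq]
  have hBb_norm : ∀ j, ‖B (b j)‖ ^ 2 = σ j ^ 2 := fun j => by
    rw [← real_inner_self_eq_norm_sq, ← adjoint_inner_right, hBb, real_inner_smul_right,
      real_inner_self_eq_norm_sq, b.orthonormal.norm_eq_one]
    simp
  have hBc_norm : ∀ i, ‖B.adjoint (c i)‖ ^ 2 = τ i ^ 2 := fun i => by
    rw [← real_inner_self_eq_norm_sq, adjoint_inner_left, hBc, real_inner_smul_right,
      real_inner_self_eq_norm_sq, c.orthonormal.norm_eq_one]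
    simp
  have hinv : ∀ s : ℝ, 0 ≤ s →
      ENNReal.ofReal s = ENNReal.ofReal s⁻¹ * ENNReal.ofReal (s ^ 2) := fun s hs => by
    rw [← ENNReal.ofReal_mul (inv_nonneg.mpr hs)]
    rcases eq_or_ne s 0 with rfl | h
    · simp
    · congr 1
      field_simp
  have hterm : ∀ i j, ENNReal.ofReal (τ i)⁻¹ * ENNReal.ofReal (⟪b j, B.adjoint (c i)⟫ ^ 2) =
      ENNReal.ofReal (σ j)⁻¹ * ENNReal.ofReal (⟪c i, B (b j)⟫ ^ 2) := fun i j => by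
    have hcomm : ⟪b j, B.adjoint (c i)⟫ = ⟪c i, B (b j)⟫ := by
      rw [adjoint_inner_right, real_inner_comm]
    have heq : σ j ^ 2 * ⟪c i, B (b j)⟫ = τ i ^ 2 * ⟪c i, B (b j)⟫ := by
      rw [← real_inner_smul_left (c i) _ (τ i ^ 2), ← hBc, ← adjoint_inner_right, hBb,
        real_inner_smul_right, adjoint_inner_left]
    rw [hcomm]
    rcases eq_or_ne ⟪c i, B (b j)⟫ 0 with h0 | h0
    · simp [h0]
    · rw [(pow_left_inj₀ (hσ j) (hτ i) two_ne_zero).mp (mul_right_cancel₀ h0 heq)]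
  calc ∑' i, ENNReal.ofReal (τ i)
      = ∑' i, ∑' j, ENNReal.ofReal (τ i)⁻¹ * ENNReal.ofReal (⟪b j, B.adjoint (c i)⟫ ^ 2) :=
        tsum_congr fun i => by
          rw [ENNReal.tsum_mul_left, b.tsum_ofReal_inner_sq, hBc_norm, ← hinv _ (hτ i)]
    _ = ∑' j, ∑' i, ENNReal.ofReal (σ j)⁻¹ * ENNReal.ofReal (⟪c i, B (b j)⟫ ^ 2) := by
        rw [ENNReal.tsum_comm]
        simp_rw [hterm]
    _ = ∑' j, ENNReal.ofReal (σ j) :=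
        tsum_congr fun j => by
          rw [ENNReal.tsum_mul_left, c.tsum_ofReal_inner_sq, hBb_norm, ← hinv _ (hσ j)]

end ContinuousLinearMap

section FeatureMap

variable {T : Type*} {H : Type*} [NormedAddCommGroup H] [InnerProductSpace ℝ H]
  {H' : Type*} [NormedAddCommGroup H'] [InnerProductSpace ℝ H']

theorem continuous_of_continuous_inner [TopologicalSpace T] {Φ : T → H}
    (h : Continuous fun p : T × T => ⟪Φ p.1, Φ p.2⟫) : Continuous Φ := by
  rw [continuous_iff_continuousAt]
  intro s
  rw [ContinuousAt, tendsto_iff_norm_sub_tendsto_zero]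
  have hsq : Continuous fun t => ⟪Φ t, Φ t⟫ - 2 * ⟪Φ t, Φ s⟫ + ⟪Φ s, Φ s⟫ :=
    ((h.comp (continuous_id.prodMk continuous_id)).sub
      (continuous_const.mul (h.comp (continuous_id.prodMk continuous_const)))).add continuous_const
  have heq : ∀ t, ‖Φ t - Φ s‖ = √(⟪Φ t, Φ t⟫ - 2 * ⟪Φ t, Φ s⟫ + ⟪Φ s, Φ s⟫) := fun t => by
    rw [← Real.sqrt_sq (norm_nonneg (Φ t - Φ s)), norm_sub_sq_real, real_inner_self_eq_norm_sq,
      real_inner_self_eq_norm_sq]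
  simp_rw [heq]
  convert (hsq.sqrt.tendsto s) using 2
  ring_nf
  simp

variable [MeasurableSpace T] {ν : Measure T}

theorem memLp_two_of_integrable_inner_self {Φ : T → H} (hΦ : AEStronglyMeasurable Φ ν)
    (hint : Integrable (fun t => ⟪Φ t, Φ t⟫) ν) : MemLp Φ 2 ν := by
  rw [memLp_two_iff_integrable_sq_norm hΦ]
  simpa only [real_inner_self_eq_norm_sq] using hint

/-- The inclusion `f ↦ (t ↦ ⟪Φ t, f⟫)` of the feature space into `L²`. -/
def featureInclusion {Φ : T → H} (hΦ : MemLp Φ 2 ν) : H →L[ℝ] Lp ℝ 2 ν :=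
  LinearMap.mkContinuous
    { toFun := fun f => (innerSL ℝ f).compLp (hΦ.toLp Φ)
      map_add' := fun f g => by rw [map_add, ContinuousLinearMap.add_compLp]
      map_smul' := fun c f => by
        rw [map_smulₛₗ, ContinuousLinearMap.smul_compLp]
        rfl }
    ‖hΦ.toLp Φ‖ fun f => by
      refine (ContinuousLinearMap.norm_compLp_le _ _).trans ?_
      rw [innerSL_apply_norm, mul_comm]

variable {Φ : T → H} (hΦ : MemLp Φ 2 ν)

theorem coeFn_featureInclusion (f : H) : featureInclusion hΦ f =ᵐ[ν] fun t => ⟪Φ t, f⟫ := by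
  have h : featureInclusion hΦ f = (innerSL ℝ f).compLp (hΦ.toLp Φ) := rfl
  rw [h]
  filter_upwards [(innerSL ℝ f).coeFn_compLp (hΦ.toLp Φ), hΦ.coeFn_toLp] with t h1 h2
  rw [h1, h2, innerSL_apply_apply, real_inner_comm]

theorem integrable_coeFn_smul (hΦ : MemLp Φ 2 ν) (g : Lp ℝ 2 ν) :
    Integrable (fun t => g t • Φ t) ν :=
  memLp_one_iff_integrable.mp (hΦ.smul (r := 1) (Lp.memLp g))

variable [CompleteSpace H]

theorem featureInclusion_adjoint_apply (g : Lp ℝ 2 ν) :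
    (featureInclusion hΦ).adjoint g = ∫ t, g t • Φ t ∂ν := by
  refine ext_inner_left ℝ fun f => ?_
  rw [ContinuousLinearMap.adjoint_inner_right, L2.inner_def,
    ← integral_inner (integrable_coeFn_smul hΦ g)]
  refine integral_congr_ae ?_
  filter_upwards [coeFn_featureInclusion hΦ f] with t ht
  rw [ht, real_inner_smul_right, real_inner_comm f]
  rfl

theorem featureInclusion_comp_adjoint_eq {K : T → T → ℝ} (hK : ∀ s t, ⟪Φ s, Φ t⟫ = K s t)
    {C : Lp ℝ 2 ν →L[ℝ] Lp ℝ 2 ν}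
    (hC : ∀ f : Lp ℝ 2 ν, ⇑(C f) =ᵐ[ν] fun x => ∫ t, K x t * f t ∂ν) :
    C = featureInclusion hΦ ∘L (featureInclusion hΦ).adjoint := by
  ext1 f
  refine Lp.ext ?_
  filter_upwards [hC f, coeFn_featureInclusion hΦ ((featureInclusion hΦ).adjoint f)] with x h1 h2
  rw [h1, ContinuousLinearMap.comp_apply, h2, featureInclusion_adjoint_apply,
    ← integral_inner (integrable_coeFn_smul hΦ f)]
  refine integral_congr_ae (Filter.Eventually.of_forall fun t => ?_)
  simp only [real_inner_smul_right, hK, mul_comm]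

theorem featureInclusion_adjoint_comp_eq {Ψ : T → H'} (hΨ : MemLp Ψ 2 ν) {R : H' →L[ℝ] H}
    (hR : ∀ f, R f = ∫ t, ⟪Ψ t, f⟫ • Φ t ∂ν) :
    R = (featureInclusion hΦ).adjoint ∘L featureInclusion hΨ := by
  ext f
  rw [hR, ContinuousLinearMap.comp_apply, featureInclusion_adjoint_apply]
  refine integral_congr_ae ?_
  filter_upwards [coeFn_featureInclusion hΨ f] with t ht
  rw [ht]

theorem isCompactOperator_of_apply_eq_integral [CompleteSpace H'] [IsProbabilityMeasure ν] {Ψ : T → H'}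
    (hΦ : MemLp Φ 2 ν) (hΨ : MemLp Ψ 2 ν) {R : H' →L[ℝ] H}
    (hR : ∀ f, R f = ∫ t, ⟪Ψ t, f⟫ • Φ t ∂ν) : IsCompactOperator R := by
  have hint : Integrable (fun t => InnerProductSpace.rankOne ℝ (Φ t) (Ψ t)) ν := by
    refine Integrable.mono' (g := fun t => ‖Φ t‖ * ‖Ψ t‖) (hΦ.norm.integrable_mul hΨ.norm) ?_
      (Filter.Eventually.of_forall fun t => (InnerProductSpace.norm_rankOne _ _).le)
    have hc : Continuous fun p : H × H' => InnerProductSpace.rankOne ℝ p.1 p.2 :=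
      (ContinuousLinearMap.smulRightL ℝ H' H).continuous₂.comp
        (((innerSL ℝ).continuous.comp continuous_snd).prodMk continuous_fst)
    exact hc.comp_aestronglyMeasurable (f := fun t => (Φ t, Ψ t))
      (hΦ.aestronglyMeasurable.prodMk hΨ.aestronglyMeasurable)
  have hReq : R = ∫ t, InnerProductSpace.rankOne ℝ (Φ t) (Ψ t) ∂ν := by
    ext f
    rw [hR, ContinuousLinearMap.integral_apply hint]
    rfl
  have hconv : Convex ℝ {f : H' →L[ℝ] H | IsCompactOperator f} :=
    (compactOperator (RingHom.id ℝ) H' H).convex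
  rw [hReq]
  refine hconv.integral_mem isClosed_setOfPred_isCompactOperator
    (Filter.Eventually.of_forall fun t => ?_) hint
  exact (isCompactOperator_of_locallyCompactSpace_rng
    (ContinuousLinearMap.toSpanSingleton ℝ (Φ t))).comp_clm (innerSL ℝ (Ψ t))

end FeatureMap

theorem eigenvalues_and_traces_covariance_vs_rkhs
    {T : Type uT} [MetricSpace T] [SigmaCompactSpace T] [MeasurableSpace T] [BorelSpace T]
    (ν : Measure T) [IsProbabilityMeasure ν]
    (K1 K2 : T → T → ℝ)
    (hK1cont : Continuous fun p : T × T => K1 p.1 p.2)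
    (hK2cont : Continuous fun p : T × T => K2 p.1 p.2)
    (hK1symm : ∀ s t, K1 s t = K1 t s) (hK2symm : ∀ s t, K2 s t = K2 t s)
    (hK1pos : ∀ (n : ℕ) (x : Fin n → T) (c : Fin n → ℝ),
      0 ≤ ∑ a, ∑ b, c a * c b * K1 (x a) (x b))
    (hK2pos : ∀ (n : ℕ) (x : Fin n → T) (c : Fin n → ℝ),
      0 ≤ ∑ a, ∑ b, c a * c b * K2 (x a) (x b))
    (κ1 κ2 : ℝ) (hκ1 : 0 < κ1) (hκ2 : 0 < κ2)
    (hK1int : Integrable (fun x => K1 x x) ν) (hK2int : Integrable (fun x => K2 x x) ν)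
    (htr1 : ∫ x, K1 x x ∂ν ≤ κ1 ^ 2) (htr2 : ∫ x, K2 x x ∂ν ≤ κ2 ^ 2)
    {H1 : Type uH1} {H2 : Type uH2} [NormedAddCommGroup H1] [InnerProductSpace ℝ H1] [CompleteSpace H1]
    [NormedAddCommGroup H2] [InnerProductSpace ℝ H2] [CompleteSpace H2]
    (Φ1 : T → H1) (Φ2 : T → H2)
    (hΦ1 : ∀ s t, ⟪Φ1 s, Φ1 t⟫ = K1 s t) (hΦ2 : ∀ s t, ⟪Φ2 s, Φ2 t⟫ = K2 s t)
    (hdense1 : (Submodule.span ℝ (Set.range Φ1)).topologicalClosure = ⊤)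
    (hdense2 : (Submodule.span ℝ (Set.range Φ2)).topologicalClosure = ⊤)
    (C1 C2 : Lp ℝ 2 ν →L[ℝ] Lp ℝ 2 ν)
    (hC1 : ∀ f : Lp ℝ 2 ν, ⇑(C1 f) =ᵐ[ν] fun x => ∫ t, K1 x t * f t ∂ν)
    (hC2 : ∀ f : Lp ℝ 2 ν, ⇑(C2 f) =ᵐ[ν] fun x => ∫ t, K2 x t * f t ∂ν)
    (R12 : H2 →L[ℝ] H1)
    (hR12 : ∀ f : H2, R12 f = ∫ t, ⟪Φ2 t, f⟫ • Φ1 t ∂ν)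
    (L1 : H1 →L[ℝ] H1) (L2 : H2 →L[ℝ] H2)
    (hL1 : ∀ u : H1, L1 u = ∫ t, ⟪Φ1 t, u⟫ • Φ1 t ∂ν)
    (hL2 : ∀ u : H2, L2 u = ∫ t, ⟪Φ2 t, u⟫ • Φ2 t ∂ν)
    {ιL ι1 ι2 : Type*} [Countable ιL] [Countable ι1] [Countable ι2]
    (eL : HilbertBasis ιL ℝ (Lp ℝ 2 ν))
    (e1 : HilbertBasis ι1 ℝ H1) (e2 : HilbertBasis ι2 ℝ H2)
    (sqC1 : Lp ℝ 2 ν →L[ℝ] Lp ℝ 2 ν)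
    (hsqC1 : sqC1.IsPositive ∧ sqC1 ∘L sqC1 = C1) :
    (∀ μ : ℝ, μ ≠ 0 →
      Cardinal.lift.{uH2}
          (Module.rank ℝ
            (Module.End.eigenspace
              ((sqC1 ∘L C2 ∘L sqC1 : Lp ℝ 2 ν →L[ℝ] Lp ℝ 2 ν) :
                Lp ℝ 2 ν →ₗ[ℝ] Lp ℝ 2 ν) μ)) =
        Cardinal.lift.{uT}
          (Module.rank ℝ
            (Module.End.eigenspace
              ((R12.adjoint ∘L R12 : H2 →L[ℝ] H2) : H2 →ₗ[ℝ] H2) μ))) ∧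
    (∀ SM : Lp ℝ 2 ν →L[ℝ] Lp ℝ 2 ν, SM.IsPositive → SM ∘L SM = sqC1 ∘L C2 ∘L sqC1 →
      ∀ SR : H2 →L[ℝ] H2, SR.IsPositive → SR ∘L SR = R12.adjoint ∘L R12 →
        (∑' k, ⟪(eL k : Lp ℝ 2 ν), SM (eL k)⟫) = ∑' k, ⟪(e2 k : H2), SR (e2 k)⟫) ∧
    (∑' k, ⟪(eL k : Lp ℝ 2 ν), C1 (eL k)⟫) = (∑' k, ⟪(e1 k : H1), L1 (e1 k)⟫) ∧
    (∑' k, ⟪(eL k : Lp ℝ 2 ν), C2 (eL k)⟫) = (∑' k, ⟪(e2 k : H2), L2 (e2 k)⟫) := by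
  have hcont1 : Continuous Φ1 := continuous_of_continuous_inner (by simpa only [hΦ1] using hK1cont)
  have hcont2 : Continuous Φ2 := continuous_of_continuous_inner (by simpa only [hΦ2] using hK2cont)
  have hm1 : MemLp Φ1 2 ν := memLp_two_of_integrable_inner_self hcont1.aestronglyMeasurable
    (by simpa only [hΦ1] using hK1int)
  have hm2 : MemLp Φ2 2 ν := memLp_two_of_integrable_inner_self hcont2.aestronglyMeasurable
    (by simpa only [hΦ2] using hK2int)
  have hCS1 := featureInclusion_comp_adjoint_eq hm1 hΦ1 hC1
  have hCS2 := featureInclusion_comp_adjoint_eq hm2 hΦ2 hC2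
  have hLS1 := featureInclusion_adjoint_comp_eq hm1 hm1 hL1
  have hLS2 := featureInclusion_adjoint_comp_eq hm2 hm2 hL2
  have hRS := featureInclusion_adjoint_comp_eq hm1 hm2 hR12
  have hsq_adj : sqC1.adjoint = sqC1 := hsqC1.1.isSelfAdjoint.adjoint_eq
  set B : H2 →L[ℝ] Lp ℝ 2 ν := sqC1 ∘L featureInclusion hm2 with hB
  have hBadj : B.adjoint = (featureInclusion hm2).adjoint ∘L sqC1 := by
    rw [hB, ContinuousLinearMap.adjoint_comp, hsq_adj]
  have hM : sqC1 ∘L C2 ∘L sqC1 = B ∘L B.adjoint := by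
    rw [hBadj, hB, hCS2]
    rfl
  have hRR : R12.adjoint ∘L R12 = B.adjoint ∘L B := by
    have h : ∀ x, sqC1 (sqC1 x) =
        featureInclusion hm1 ((featureInclusion hm1).adjoint x) := fun x => by
      rw [← ContinuousLinearMap.comp_apply, hsqC1.2, hCS1]
      rfl
    rw [hBadj, hB, hRS, ContinuousLinearMap.adjoint_comp, ContinuousLinearMap.adjoint_adjoint]
    ext1 f
    simp only [ContinuousLinearMap.comp_apply, h]
  have hspan : (⨆ μ, Module.End.eigenspace
      ((B.adjoint ∘L B : H2 →L[ℝ] H2) : H2 →ₗ[ℝ] H2) μ)ᗮ = ⊥ := by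
    refine ContinuousLinearMap.orthogonalComplement_iSup_eigenspaces_eq_bot ?_
      (ContinuousLinearMap.isPositive_adjoint_comp_self B).isSymmetric
    rw [← hRR]
    exact (isCompactOperator_of_apply_eq_integral hm1 hm2 hR12).clm_comp R12.adjoint
  refine ⟨fun μ hμ => ?_, fun SM hSM hSM2 SR hSR hSR2 => ?_, ?_, ?_⟩
  · rw [hM, hRR]
    exact (B.eigenspaceAdjointCompEquiv hμ).symm.lift_rank_eq
  · exact B.tsum_inner_sqrt_comp_adjoint e2 eL hspan hSM (hSM2.trans hM) hSR (hSR2.trans hRR)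
  · rw [hCS1, hLS1]
    exact (featureInclusion hm1).tsum_inner_comp_adjoint e1 eL
  · rw [hCS2, hLS2]
    exact (featureInclusion hm2).tsum_inner_comp_adjoint e2 eL

end
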